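/- Let R be a commutative ring and (A, D_G) a 1-tilting cotorsion pair with associated Gabriel topology G. If A is a covering class, then ψ_R : R → R_G is a perfect localisation, p.dim R_G ≤ 1, and R is G-almost perfect (R_G is a perfect ring and R/J is a perfect ring for every J ∈ G). -/

import Mathlib

universe u

/-- A Gabriel topology on a commutative ring `R`: a filter of ideals of `R`
satisfying the Gabriel axiom T4. -/
structure GabrielTopology (R : Type u) [CommRing R] : Type u where
  sets : Set (Ideal R)
  top_mem : (⊤ : Ideal R) ∈ sets
  mem_of_le : ∀ {I J : Ideal R}, I ∈ sets → I ≤ J → J ∈ sets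
  inf_mem : ∀ {I J : Ideal R}, I ∈ sets → J ∈ sets → I ⊓ J ∈ sets
  gabriel : ∀ I J : Ideal R, J ∈ sets →
    (∀ r ∈ J, Submodule.colon I (Ideal.span {r}) ∈ sets) → I ∈ sets

namespace GabrielTopology

variable {R : Type u} [CommRing R] (G : GabrielTopology R)

/-- A module `M` is `G`-torsion if the annihilator of every element belongs to `G`. -/
def IsTorsion (M : Type u) [AddCommGroup M] [Module R M] : Prop :=
  ∀ x : M, Ideal.torsionOf R M x ∈ G.sets

/-- A module `M` is `G`-torsion-free if no nonzero element is annihilated by an ideal of `G`. -/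
def IsTorsionFree (M : Type u) [AddCommGroup M] [Module R M] : Prop :=
  ∀ x : M, Ideal.torsionOf R M x ∈ G.sets → x = 0

/-- A module `M` is `G`-divisible if `JM = M` for every `J ∈ G`. -/
def IsDivisible (M : Type u) [AddCommGroup M] [Module R M] : Prop :=
  ∀ J ∈ G.sets, J • (⊤ : Submodule R M) = ⊤

/-- `G` is faithful if `R` is `G`-torsion-free. -/
def Faithful : Prop := ∀ r : R, Ideal.torsionOf R R r ∈ G.sets → r = 0

/-- `G` is finitely generated if it has a basis of finitely generated ideals. -/
def FinitelyGenerated : Prop := ∀ J ∈ G.sets, ∃ J' ∈ G.sets, J' ≤ J ∧ J'.FG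

end GabrielTopology

/-- `Ext¹_R(M, N) = 0`, expressed by the standard characterisation:
every short exact sequence `0 → N → E → M → 0` splits. -/
def Ext1Vanish (R : Type u) [CommRing R] (M N : Type u) [AddCommGroup M] [Module R M]
    [AddCommGroup N] [Module R N] : Prop :=
  ∀ (E : Type u) [AddCommGroup E] [Module R E] (i : N →ₗ[R] E) (p : E →ₗ[R] M),
    Function.Injective i → Function.Surjective p → LinearMap.range i = LinearMap.ker p →
      ∃ s : M →ₗ[R] E, p ∘ₗ s = LinearMap.id

/-- `M` has projective dimension at most 1: the kernel of a free cover is projective. -/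
def ProjDimLE1 (R : Type u) [CommRing R] (M : Type u) [AddCommGroup M] [Module R M] : Prop :=
  ∃ (ι : Type u) (p : (ι →₀ R) →ₗ[R] M),
    Function.Surjective p ∧ Module.Projective R ↥(LinearMap.ker p)

/-- `M ∈ Add(T)`: `M` is a direct summand of a direct sum of copies of `T`. -/
def InAdd (R : Type u) [CommRing R] (T M : Type u) [AddCommGroup T] [Module R T]
    [AddCommGroup M] [Module R M] : Prop :=
  ∃ (ι : Type u) (s : M →ₗ[R] (ι →₀ T)) (r : (ι →₀ T) →ₗ[R] M), r ∘ₗ s = LinearMap.id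

/-- `T` is a 1-tilting module: (T1) `p.dim T ≤ 1`, (T2) `Ext¹(T, T^(κ)) = 0` for all κ,
(T3) there is an exact sequence `0 → R → T₀ → T₁ → 0` with `T₀, T₁ ∈ Add(T)`. -/
def Is1Tilting (R : Type u) [CommRing R] (T : Type u) [AddCommGroup T] [Module R T] : Prop :=
  ProjDimLE1 R T ∧
  (∀ ι : Type u, Ext1Vanish R T (ι →₀ T)) ∧
  ∃ (T0 T1 : ModuleCat.{u} R) (i : R →ₗ[R] ↥T0) (p : ↥T0 →ₗ[R] ↥T1),
    InAdd R T ↥T0 ∧ InAdd R T ↥T1 ∧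
    Function.Injective i ∧ Function.Surjective p ∧ LinearMap.range i = LinearMap.ker p

namespace GabrielTopology

variable {R : Type u} [CommRing R] (G : GabrielTopology R)

/-- `(𝒜, 𝒟_G)` is a 1-tilting cotorsion pair with associated Gabriel topology `G`:
`G` is a faithful finitely generated Gabriel topology and the class of `G`-divisible
modules is the tilting class of a 1-tilting module. -/
def IsTiltingTopology : Prop :=
  G.Faithful ∧ G.FinitelyGenerated ∧
  ∃ T : ModuleCat.{u} R, Is1Tilting R ↥T ∧
    ∀ (M : Type u) [AddCommGroup M] [Module R M], (Ext1Vanish R ↥T M ↔ G.IsDivisible M)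

/-- Membership in the left-hand class `𝒜 = ᗮ(𝒟_G)` of the 1-tilting cotorsion pair. -/
def MemA (M : Type u) [AddCommGroup M] [Module R M] : Prop :=
  ∀ (D : Type u) [AddCommGroup D] [Module R D], G.IsDivisible D → Ext1Vanish R M D

/-- The class `𝒜` is covering: every module has an `𝒜`-cover. -/
def IsACovering : Prop :=
  ∀ (M : Type u) [AddCommGroup M] [Module R M],
    ∃ (C : ModuleCat.{u} R) (φ : ↥C →ₗ[R] M),
      G.MemA ↥C ∧
      (∀ (C' : Type u) [AddCommGroup C'] [Module R C'], G.MemA C' →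
        ∀ f : C' →ₗ[R] M, ∃ g : C' →ₗ[R] ↥C, φ ∘ₗ g = f) ∧
      (∀ e : ↥C →ₗ[R] ↥C, φ ∘ₗ e = φ → Function.Bijective e)

/-- The class `𝒜` is closed under direct limits. -/
def AClosedUnderDirectLimits : Prop :=
  ∀ (ι : Type u) [Preorder ι] [IsDirected ι (· ≤ ·)] [Nonempty ι] [DecidableEq ι]
    (M : ι → Type u) [∀ i, AddCommGroup (M i)] [∀ i, Module R (M i)]
    (f : ∀ i j, i ≤ j → M i →ₗ[R] M j) [DirectedSystem M fun i j h => f i j h],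
    (∀ i, G.MemA (M i)) → G.MemA (Module.DirectLimit M f)

/-- `Q`, via `algebraMap R Q`, is the ring of quotients `R_G` of `R` with respect to `G`:
`Q` is `G`-torsion-free and `G`-injective (i.e. `G`-closed) and the kernel and cokernel
of `R → Q` are `G`-torsion. -/
structure IsRingOfQuotients (Q : Type u) [CommRing Q] [Algebra R Q] : Prop where
  torsionFree : ∀ q : Q, Ideal.torsionOf R Q q ∈ G.sets → q = 0
  gInjective : ∀ J ∈ G.sets, ∀ f : ↥J →ₗ[R] Q, ∃ q : Q, ∀ j : ↥J, f j = (j : R) • q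
  ker_torsion : ∀ r : R, algebraMap R Q r = 0 → Ideal.torsionOf R R r ∈ G.sets
  coker_torsion : ∀ q : Q, ∃ J ∈ G.sets, ∀ x ∈ J, ∃ r : R, x • q = algebraMap R Q r

/-- `G` is a perfect Gabriel topology, realised by the perfect localisation `Q`:
`R → Q` is a flat ring epimorphism and `G = {J ∣ JQ = Q}`. -/
def IsPerfectLocalization (Q : Type u) [CommRing Q] [Algebra R Q] : Prop :=
  Module.Flat R Q ∧
  (∀ (S : Type u) [CommRing S] (f g : Q →+* S),
    f.comp (algebraMap R Q) = g.comp (algebraMap R Q) → f = g) ∧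
  (∀ J : Ideal R, J ∈ G.sets ↔ J • (⊤ : Submodule R Q) = ⊤)

end GabrielTopology

/-- A commutative ring is perfect iff every flat module is projective. -/
def IsPerfectRing (S : Type u) [CommRing S] : Prop :=
  ∀ (M : Type u) [AddCommGroup M] [Module S M], Module.Flat S M → Module.Projective S M

/-- `X` is Σ-pure-split: every pure embedding `A ⊆ B` with `B ∈ Add(X)` splits. -/
def SigmaPureSplit (R : Type u) [CommRing R] (X : Type u) [AddCommGroup X] [Module R X] : Prop :=
  ∀ (A B : Type u) [AddCommGroup A] [Module R A] [AddCommGroup B] [Module R B] (i : A →ₗ[R] B),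
    Function.Injective i →
    (∀ (M : Type u) [AddCommGroup M] [Module R M], Function.Injective (LinearMap.rTensor M i)) →
    InAdd R X B → ∃ r : B →ₗ[R] A, r ∘ₗ i = LinearMap.id

/-- A concrete model of `Ext¹_R(M, N)`, computed from the canonical free presentation
`0 → S → (M →₀ R) → M → 0` of `M` as `coker (Hom((M →₀ R), N) → Hom(S, N))`. -/
abbrev ext1 (R : Type u) [CommRing R] (M N : Type u) [AddCommGroup M] [Module R M]
    [AddCommGroup N] [Module R N] : Type u :=
  (↥(LinearMap.ker (Finsupp.linearCombination R (id : M → M))) →ₗ[R] N) ⧸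
    LinearMap.range
      (LinearMap.lcomp R N (LinearMap.ker (Finsupp.linearCombination R (id : M → M))).subtype)

/-- A concrete model of `Tor₁^R(M, N)`, computed from the canonical free presentation
`0 → S → (M →₀ R) → M → 0` of `M` as `ker (S ⊗ N → (M →₀ R) ⊗ N)`. -/
abbrev tor1 (R : Type u) [CommRing R] (M N : Type u) [AddCommGroup M] [Module R M]
    [AddCommGroup N] [Module R N] : Type u :=
  ↥(LinearMap.ker
    (LinearMap.rTensor N (LinearMap.ker (Finsupp.linearCombination R (id : M → M))).subtype))

/-- The cokernel `U/R` of a ring map `R → U`. -/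
abbrev cokerAlg (R U : Type u) [CommRing R] [CommRing U] [Algebra R U] : Type u :=
  U ⧸ LinearMap.range (Algebra.linearMap R U)

/-- A linear topology on a commutative ring `R`, given by its filter of open ideals. -/
structure LinearTopologyOn (R : Type u) [CommRing R] : Type u where
  sets : Set (Ideal R)
  top_mem : (⊤ : Ideal R) ∈ sets
  mem_of_le : ∀ {I J : Ideal R}, I ∈ sets → I ≤ J → J ∈ sets
  inf_mem : ∀ {I J : Ideal R}, I ∈ sets → J ∈ sets → I ⊓ J ∈ sets

/-- An `R`-module `M` is `H`-discrete if the annihilator of every element is open. -/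
def LinearTopologyOn.IsDiscrete {R : Type u} [CommRing R] (H : LinearTopologyOn R)
    (M : Type u) [AddCommGroup M] [Module R M] : Prop :=
  ∀ x : M, Ideal.torsionOf R M x ∈ H.sets

/-- `R` is `H`-h-local: every open ideal is contained in only finitely many maximal ideals,
and every open prime ideal is contained in only one maximal ideal. -/
def LinearTopologyOn.IsHLocal {R : Type u} [CommRing R] (H : LinearTopologyOn R) : Prop :=
  (∀ J ∈ H.sets, {m : Ideal R | m.IsMaximal ∧ J ≤ m}.Finite) ∧
  (∀ p ∈ H.sets, p.IsPrime →
    ∀ m n : Ideal R, m.IsMaximal → n.IsMaximal → p ≤ m → p ≤ n → m = n)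

/-- Over `S`, `M` admits a resolution of length `n` by finitely generated projectives. -/
def FGProjDimLE (S : Type u) [CommRing S] :
    ℕ → ∀ (M : Type u) [AddCommGroup M] [Module S M], Prop
  | 0, M, iA, iM =>
      letI := iA; letI := iM
      Module.Finite S M ∧ Module.Projective S M
  | n + 1, M, iA, iM =>
      letI := iA; letI := iM
      ∃ (k : ℕ) (f : (Fin k → S) →ₗ[S] M),
        Function.Surjective f ∧ FGProjDimLE S n ↥(LinearMap.ker f)

namespace Ext1Vanish

variable {R : Type u} [CommRing R]
variable {M N A E F : Type u} [AddCommGroup M] [Module R M] [AddCommGroup N] [Module R N]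
  [AddCommGroup A] [Module R A] [AddCommGroup E] [Module R E] [AddCommGroup F] [Module R F]

theorem exists_lift (h : Ext1Vanish R M N) (i : N →ₗ[R] E) (p : E →ₗ[R] F)
    (hi : Function.Injective i) (hp : Function.Surjective p)
    (hip : LinearMap.range i = LinearMap.ker p) (f : M →ₗ[R] F) :
    ∃ g : M →ₗ[R] E, p ∘ₗ g = f := by
  let S : Submodule R (E × M) :=
    LinearMap.eqLocus (p ∘ₗ LinearMap.fst R E M) (f ∘ₗ LinearMap.snd R E M)
  have hpi : ∀ n, p (i n) = 0 := fun n => by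
    rw [← LinearMap.mem_ker, ← hip]; exact ⟨n, rfl⟩
  let j : N →ₗ[R] S := LinearMap.codRestrict S (LinearMap.inl R E M ∘ₗ i) fun n => by
    simp [S, LinearMap.mem_eqLocus, hpi]
  let q : S →ₗ[R] M := LinearMap.snd R E M ∘ₗ S.subtype
  have hj : Function.Injective j := fun a b hab =>
    hi (congrArg (fun x : S => (x : E × M).1) hab)
  have hq : Function.Surjective q := by
    intro m
    obtain ⟨e, he⟩ := hp (f m)
    exact ⟨⟨(e, m), he⟩, rfl⟩
  have hjq : LinearMap.range j = LinearMap.ker q := by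
    ext ⟨⟨e, m⟩, hem⟩
    have hem' : p e = f m := hem
    constructor
    · rintro ⟨n, hn⟩
      exact (congrArg (fun x : S => (x : E × M).2) hn).symm
    · intro hm
      obtain rfl : m = 0 := hm
      have : e ∈ LinearMap.range i := by rw [hip]; simpa using hem'
      obtain ⟨n, rfl⟩ := this
      exact ⟨n, rfl⟩
  obtain ⟨s, hs⟩ := h S j q hj hq hjq
  refine ⟨LinearMap.fst R E M ∘ₗ S.subtype ∘ₗ s, ?_⟩
  ext m
  have h1 : p (s m : E × M).1 = f (s m : E × M).2 := (s m).2
  have h2 : (s m : E × M).2 = m := LinearMap.congr_fun hs m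
  simpa [h2] using h1

/-- Lifting along a surjection whose kernel is orthogonal to the source. -/
theorem exists_lift_ker (p : E →ₗ[R] F) (hp : Function.Surjective p)
    (h : Ext1Vanish R M (LinearMap.ker p)) (f : M →ₗ[R] F) :
    ∃ g : M →ₗ[R] E, p ∘ₗ g = f :=
  h.exists_lift (LinearMap.ker p).subtype p (Submodule.subtype_injective _) hp (by simp) f

theorem of_retract {P : Type u} [AddCommGroup P] [Module R P] (h : Ext1Vanish R P N)
    (s : M →ₗ[R] P) (r : P →ₗ[R] M) (hrs : r ∘ₗ s = LinearMap.id) : Ext1Vanish R M N := by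
  intro E _ _ i p hi hp hip
  obtain ⟨g, hg⟩ := h.exists_lift i p hi hp hip r
  exact ⟨g ∘ₗ s, by rw [← LinearMap.comp_assoc, hg, hrs]⟩

theorem finsupp (h : Ext1Vanish R M N) (ι : Type u) : Ext1Vanish R (ι →₀ M) N := by
  intro E _ _ i p hi hp hip
  choose g hg using fun k : ι => h.exists_lift i p hi hp hip (Finsupp.lsingle k)
  refine ⟨Finsupp.lsum R g, ?_⟩
  ext k m : 2
  simpa using LinearMap.congr_fun (hg k) m

theorem of_projective [Module.Projective R M] : Ext1Vanish R M N := by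
  intro E _ _ i p hi hp hip
  exact Module.projective_lifting_property p LinearMap.id hp

theorem exists_section_of_retraction (i : N →ₗ[R] E) (p : E →ₗ[R] M)
    (hp : Function.Surjective p) (hip : LinearMap.range i = LinearMap.ker p)
    (r : E →ₗ[R] N) (hr : r ∘ₗ i = LinearMap.id) :
    ∃ s : M →ₗ[R] E, p ∘ₗ s = LinearMap.id := by
  have hpi : ∀ n, p (i n) = 0 := fun n => by
    rw [← LinearMap.mem_ker, ← hip]; exact ⟨n, rfl⟩
  have hker : LinearMap.ker p ≤ LinearMap.ker (LinearMap.id - i ∘ₗ r) := by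
    rw [← hip]
    rintro _ ⟨n, rfl⟩
    simp [show r (i n) = n from LinearMap.congr_fun hr n]
  refine ⟨(LinearMap.ker p).liftQ (LinearMap.id - i ∘ₗ r) hker ∘ₗ
    (p.quotKerEquivOfSurjective hp).symm.toLinearMap, ?_⟩
  ext m
  obtain ⟨e, rfl⟩ := hp m
  have : (p.quotKerEquivOfSurjective hp).symm (p e) = (LinearMap.ker p).mkQ e := by
    rw [LinearEquiv.symm_apply_eq]; rfl
  simp [this, hpi]

theorem exists_extend (h : Ext1Vanish R M N) (i : A →ₗ[R] E) (p : E →ₗ[R] M)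
    (hi : Function.Injective i) (hp : Function.Surjective p)
    (hip : LinearMap.range i = LinearMap.ker p) (f : A →ₗ[R] N) :
    ∃ g : E →ₗ[R] N, g ∘ₗ i = f := by
  have hpi : ∀ n, p (i n) = 0 := fun n => by
    rw [← LinearMap.mem_ker, ← hip]; exact ⟨n, rfl⟩
  let W : Submodule R (N × E) := LinearMap.range (LinearMap.prod f (-i))
  let j : N →ₗ[R] (N × E) ⧸ W := W.mkQ ∘ₗ LinearMap.inl R N E
  have hW : W ≤ LinearMap.ker (p ∘ₗ LinearMap.snd R N E) := by
    rintro _ ⟨a, rfl⟩; simp [hpi]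
  let q : ((N × E) ⧸ W) →ₗ[R] M := W.liftQ (p ∘ₗ LinearMap.snd R N E) hW
  have hji : ∀ a, W.mkQ (0, i a) = j (f a) := fun a => by
    rw [← sub_eq_zero]
    simp only [j, LinearMap.comp_apply, ← map_sub, LinearMap.inl_apply]
    rw [Submodule.mkQ_apply, Submodule.Quotient.mk_eq_zero]
    exact ⟨-a, by simp⟩
  have hj : Function.Injective j := by
    rw [← LinearMap.ker_eq_bot, LinearMap.ker_eq_bot']
    intro n hn
    rw [LinearMap.comp_apply, Submodule.mkQ_apply, Submodule.Quotient.mk_eq_zero] at hn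
    obtain ⟨a, ha⟩ := hn
    have h1 : f a = n := congrArg Prod.fst ha
    have h2 : -i a = 0 := congrArg Prod.snd ha
    have h3 : a = 0 := hi (by simpa using h2)
    rw [← h1, h3, map_zero]
  have hq : Function.Surjective q := fun m => by
    obtain ⟨e, rfl⟩ := hp m
    exact ⟨W.mkQ (0, e), by simp [q]⟩
  have hjq : LinearMap.range j = LinearMap.ker q := by
    apply le_antisymm
    · rintro _ ⟨n, rfl⟩; simp [j, q]
    · intro x hx
      obtain ⟨⟨n, e⟩, rfl⟩ := W.mkQ_surjective x
      have he : e ∈ LinearMap.ker p := by simpa [q] using hx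
      rw [← hip] at he
      obtain ⟨a, rfl⟩ := he
      refine ⟨n + f a, ?_⟩
      rw [map_add, ← hji]
      simp [j, ← Submodule.Quotient.mk_add]
  obtain ⟨s, hs⟩ := h _ j q hj hq hjq
  have key : ∀ x, x - s (q x) ∈ LinearMap.range j := fun x => by
    rw [hjq, LinearMap.mem_ker, map_sub, sub_eq_zero]
    exact (LinearMap.congr_fun hs (q x)).symm
  let ρ : ((N × E) ⧸ W) →ₗ[R] N := (LinearEquiv.ofInjective j hj).symm.toLinearMap ∘ₗ
    LinearMap.codRestrict (LinearMap.range j) (LinearMap.id - s ∘ₗ q) key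
  have hρ : ∀ n, ρ (j n) = n := fun n => by
    have h0 : q (j n) = 0 := by rw [← LinearMap.mem_ker, ← hjq]; exact ⟨n, rfl⟩
    simp only [ρ, LinearMap.comp_apply, LinearEquiv.coe_coe]
    rw [LinearEquiv.symm_apply_eq]
    ext1
    simp [h0]
  refine ⟨ρ ∘ₗ W.mkQ ∘ₗ LinearMap.inr R N E, ?_⟩
  ext a
  simp only [LinearMap.comp_apply, LinearMap.inr_apply, hji, hρ]

/-- The left `Ext`-orthogonal of a module is closed under extensions. -/
theorem of_extension (hA : Ext1Vanish R A N) (hM : Ext1Vanish R M N) (i : A →ₗ[R] F)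
    (p : F →ₗ[R] M) (hi : Function.Injective i) (hp : Function.Surjective p)
    (hip : LinearMap.range i = LinearMap.ker p) : Ext1Vanish R F N := by
  intro E _ _ j q hj hq hjq
  have hpi : ∀ n, p (i n) = 0 := fun n => by
    rw [← LinearMap.mem_ker, ← hip]; exact ⟨n, rfl⟩
  have hqj : ∀ n, q (j n) = 0 := fun n => by
    rw [← LinearMap.mem_ker, ← hjq]; exact ⟨n, rfl⟩
  obtain ⟨s, hs⟩ := hA.exists_lift j q hj hq hjq i
  have hs' : ∀ a, q (s a) = i a := fun a => LinearMap.congr_fun hs a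
  let W := LinearMap.range s
  have hW : W ≤ LinearMap.ker (p ∘ₗ q) := by
    rintro _ ⟨a, rfl⟩; simp [hs', hpi]
  let j' : N →ₗ[R] E ⧸ W := W.mkQ ∘ₗ j
  let q' : (E ⧸ W) →ₗ[R] M := W.liftQ (p ∘ₗ q) hW
  have hj' : Function.Injective j' := by
    rw [← LinearMap.ker_eq_bot, LinearMap.ker_eq_bot']
    intro n hn
    rw [LinearMap.comp_apply, Submodule.mkQ_apply, Submodule.Quotient.mk_eq_zero] at hn
    obtain ⟨a, ha⟩ := hn
    have : i a = 0 := by rw [← hs', ha, hqj]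
    have ha0 : a = 0 := hi (by simpa using this)
    exact hj (by rw [← ha, ha0, map_zero, map_zero])
  have hq' : Function.Surjective q' := by
    intro m
    obtain ⟨x, rfl⟩ := hp m
    obtain ⟨e, rfl⟩ := hq x
    exact ⟨W.mkQ e, by simp [q']⟩
  have hjq' : LinearMap.range j' = LinearMap.ker q' := by
    apply le_antisymm
    · rintro _ ⟨n, rfl⟩; simp [j', q', hqj]
    · intro x hx
      obtain ⟨e, rfl⟩ := W.mkQ_surjective x
      have he : q e ∈ LinearMap.ker p := by simpa [q'] using hx
      rw [← hip] at he
      obtain ⟨a, ha⟩ := he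
      have : e - s a ∈ LinearMap.range j := by rw [hjq]; simp [hs', ha]
      obtain ⟨n, hn⟩ := this
      refine ⟨n, ?_⟩
      simp only [j', LinearMap.comp_apply, hn, map_sub, sub_eq_self, Submodule.mkQ_apply,
        Submodule.Quotient.mk_eq_zero]
      exact ⟨a, rfl⟩
  obtain ⟨g, hg⟩ := hM.exists_extend j' q' hj' hq' hjq' LinearMap.id
  exact exists_section_of_retraction j q hq hjq (g ∘ₗ W.mkQ) hg

end Ext1Vanish

namespace GabrielTopology

variable {R : Type u} [CommRing R] {G : GabrielTopology R}
variable {M N : Type u} [AddCommGroup M] [Module R M] [AddCommGroup N] [Module R N]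

theorem IsDivisible.of_surjective (h : G.IsDivisible M) (f : M →ₗ[R] N)
    (hf : Function.Surjective f) : G.IsDivisible N := fun J hJ => by
  have := congrArg (Submodule.map f) (h J hJ)
  rwa [Submodule.map_smul'', Submodule.map_top, LinearMap.range_eq_top.2 hf] at this

theorem IsDivisible.range (h : G.IsDivisible M) (f : M →ₗ[R] N) :
    G.IsDivisible (LinearMap.range f) :=
  h.of_surjective f.rangeRestrict f.surjective_rangeRestrict

theorem IsDivisible.finsupp (h : G.IsDivisible M) (ι : Type u) : G.IsDivisible (ι →₀ M) :=
  fun J hJ => by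
  rw [eq_top_iff]
  rintro x -
  induction x using Finsupp.induction_linear with
  | zero => exact zero_mem _
  | add x y hx hy => exact add_mem hx hy
  | single k m =>
    have hm : m ∈ J • (⊤ : Submodule R M) := by rw [h J hJ]; trivial
    have := Submodule.mem_map_of_mem (f := Finsupp.lsingle (R := R) k) hm
    rw [Submodule.map_smul''] at this
    exact Submodule.smul_mono le_rfl le_top this

theorem IsDivisible.tensor (h : G.IsDivisible M) : G.IsDivisible (TensorProduct R N M) :=
  fun J hJ => by
  rw [eq_top_iff]
  rintro x -
  induction x using TensorProduct.induction_on with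
  | zero => exact zero_mem _
  | add x y hx hy => exact add_mem hx hy
  | tmul n m =>
    have hm : m ∈ J • (⊤ : Submodule R M) := by rw [h J hJ]; trivial
    have := Submodule.mem_map_of_mem (f := TensorProduct.mk R N M n) hm
    rw [Submodule.map_smul''] at this
    exact Submodule.smul_mono le_rfl le_top this

theorem MemA.of_retract (h : G.MemA M) (s : N →ₗ[R] M) (r : M →ₗ[R] N)
    (hrs : r ∘ₗ s = LinearMap.id) : G.MemA N :=
  fun D _ _ hD => (h D hD).of_retract s r hrs

theorem MemA.of_equiv (h : G.MemA M) (e : M ≃ₗ[R] N) : G.MemA N :=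
  h.of_retract e.symm.toLinearMap e.toLinearMap (by ext; simp)

theorem MemA.finsupp (h : G.MemA M) (ι : Type u) : G.MemA (ι →₀ M) :=
  fun D _ _ hD => (h D hD).finsupp ι

theorem MemA.finsupp_nat (h : G.MemA M) : G.MemA (ℕ →₀ M) :=
  (h.finsupp (ULift.{u} ℕ)).of_equiv (Finsupp.domLCongr Equiv.ulift)

theorem IsDivisible.finsupp_nat (h : G.IsDivisible M) : G.IsDivisible (ℕ →₀ M) :=
  (h.finsupp (ULift.{u} ℕ)).of_surjective
    (Finsupp.domLCongr (R := R) (M := M) Equiv.ulift).toLinearMap (LinearEquiv.surjective _)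

theorem memA_of_projective [Module.Projective R M] : G.MemA M :=
  fun _ _ _ _ => Ext1Vanish.of_projective

theorem MemA.of_extension {E : Type u} [AddCommGroup E] [Module R E] (hN : G.MemA N)
    (hM : G.MemA M) (i : N →ₗ[R] E) (p : E →ₗ[R] M) (hi : Function.Injective i)
    (hp : Function.Surjective p) (hip : LinearMap.range i = LinearMap.ker p) : G.MemA E :=
  fun D _ _ hD => (hN D hD).of_extension (hM D hD) i p hi hp hip

theorem MemA.exists_lift {E F : Type u} [AddCommGroup E] [Module R E] [AddCommGroup F]
    [Module R F] (hM : G.MemA M) (p : E →ₗ[R] F) (hp : Function.Surjective p)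
    (hD : G.IsDivisible (LinearMap.ker p)) (f : M →ₗ[R] F) : ∃ g : M →ₗ[R] E, p ∘ₗ g = f :=
  (hM _ hD).exists_lift_ker p hp f

/-- The class of divisible modules is `T`-orthogonal for some `T` in the left-hand class. -/
theorem IsTiltingTopology.exists_test (hG : G.IsTiltingTopology) :
    ∃ T : ModuleCat.{u} R, G.MemA T ∧
      ∀ (M : Type u) [AddCommGroup M] [Module R M], Ext1Vanish R T M → G.IsDivisible M := by
  obtain ⟨-, -, T, -, hT⟩ := hG
  exact ⟨T, fun D _ _ hD => (hT D).2 hD, fun M _ _ => (hT M).1⟩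

theorem IsTiltingTopology.exists_preenvelope (hG : G.IsTiltingTopology) :
    ∃ (X Y : ModuleCat.{u} R) (i : R →ₗ[R] X) (p : X →ₗ[R] Y),
      G.MemA X ∧ G.IsDivisible X ∧ G.MemA Y ∧ G.IsDivisible Y ∧
      Function.Injective i ∧ Function.Surjective p ∧ LinearMap.range i = LinearMap.ker p := by
  obtain ⟨-, -, T, ⟨-, hT2, X, Y, i, p, hX, hY, hi, hp, hip⟩, hT⟩ := hG
  have hA : G.MemA T := fun D _ _ hD => (hT D).2 hD
  have hadd : ∀ (M : Type u) [AddCommGroup M] [Module R M], InAdd R T M →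
      G.MemA M ∧ G.IsDivisible M := by
    rintro M _ _ ⟨ι, s, r, hrs⟩
    exact ⟨(hA.finsupp ι).of_retract s r hrs, ((hT _).1 (hT2 ι)).of_surjective r
      fun m => ⟨s m, LinearMap.congr_fun hrs m⟩⟩
  exact ⟨X, Y, i, p, (hadd X hX).1, (hadd X hX).2, (hadd Y hY).1, (hadd Y hY).2, hi, hp, hip⟩

theorem IsTiltingTopology.isDivisible_of_injective (hG : G.IsTiltingTopology)
    [hM : Module.Injective R M] : G.IsDivisible M := by
  obtain ⟨T, -, hT⟩ := hG.exists_test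
  refine hT M fun E _ _ i p hi hp hip => ?_
  obtain ⟨r, hr⟩ := hM.out i hi LinearMap.id
  exact Ext1Vanish.exists_section_of_retraction i p hp hip r (LinearMap.ext hr)

theorem exists_injective_embedding (M : Type u) [AddCommGroup M] [Module R M] :
    ∃ (E : ModuleCat.{u} R) (j : M →ₗ[R] E), Module.Injective R E ∧ Function.Injective j := by
  obtain ⟨⟨E, hE, f, hf⟩⟩ :=
    CategoryTheory.EnoughInjectives.presentation (ModuleCat.of R M)
  exact ⟨E, f.hom, Module.injective_module_of_injective_object R E,
    (ModuleCat.mono_iff_injective f).1 hf⟩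

theorem projective_of_lifts {K : Type u} [AddCommGroup K] [Module R K]
    (h : ∀ (E : Type u) [AddCommGroup E] [Module R E], Module.Injective R E →
      ∀ (W : Submodule R E) (v : K →ₗ[R] E ⧸ W), ∃ w : K →ₗ[R] E, W.mkQ ∘ₗ w = v) :
    Module.Projective R K := by
  refine Module.Projective.of_lifting_property'' fun f hf => ?_
  obtain ⟨E, j, hE, hj⟩ := exists_injective_embedding (R := R) (K →₀ R)
  obtain ⟨W, hWdef⟩ : ∃ W, W = (LinearMap.ker f).map j := ⟨_, rfl⟩
  have hW : LinearMap.ker f ≤ LinearMap.ker (W.mkQ ∘ₗ j) := fun x hx => by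
    rw [LinearMap.mem_ker, LinearMap.comp_apply, Submodule.mkQ_apply,
      Submodule.Quotient.mk_eq_zero, hWdef]
    exact Submodule.mem_map_of_mem hx
  obtain ⟨v, hv⟩ : ∃ v : K →ₗ[R] E ⧸ W, ∀ x, v (f x) = W.mkQ (j x) := by
    refine ⟨(LinearMap.ker f).liftQ (W.mkQ ∘ₗ j) hW ∘ₗ
      (f.quotKerEquivOfSurjective hf).symm.toLinearMap, fun x => ?_⟩
    have : (f.quotKerEquivOfSurjective hf).symm (f x) = (LinearMap.ker f).mkQ x := by
      rw [LinearEquiv.symm_apply_eq]; rfl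
    simp [this]
  obtain ⟨w, hw⟩ := h E hE W v
  have key : ∀ k : K, ∃ x, j x = w k ∧ f x = k := fun k => by
    obtain ⟨x, rfl⟩ := hf k
    have h1 : W.mkQ (w (f x)) = W.mkQ (j x) := by
      rw [← hv, ← hw]; rfl
    rw [← sub_eq_zero, ← map_sub, Submodule.mkQ_apply, Submodule.Quotient.mk_eq_zero, hWdef] at h1
    obtain ⟨n, hn, hn'⟩ := h1
    exact ⟨x + n, by rw [map_add, hn']; abel, by rw [map_add, show f n = 0 from hn, add_zero]⟩
  choose x hx hxk using key
  refine ⟨{ toFun := x, map_add' := fun a b => hj ?_, map_smul' := fun r a => hj ?_ },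
    LinearMap.ext hxk⟩
  · simp [hx]
  · simp [hx]

theorem IsTiltingTopology.projective_ker (hG : G.IsTiltingTopology) (hM : G.MemA M)
    {F : Type u} [AddCommGroup F] [Module R F] [Module.Projective R F] (p : F →ₗ[R] M)
    (hp : Function.Surjective p) : Module.Projective R (LinearMap.ker p) := by
  refine projective_of_lifts fun E _ _ hE W v => ?_
  have hD : G.IsDivisible (E ⧸ W) :=
    hG.isDivisible_of_injective.of_surjective W.mkQ W.mkQ_surjective
  obtain ⟨g, hg⟩ := (hM _ hD).exists_extend (LinearMap.ker p).subtype p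
    (Submodule.subtype_injective _) hp (by simp) v
  obtain ⟨w, hw⟩ := Module.projective_lifting_property W.mkQ g W.mkQ_surjective
  exact ⟨w ∘ₗ (LinearMap.ker p).subtype, by rw [← hg, ← hw]; rfl⟩

theorem IsTiltingTopology.projDimLE1 (hG : G.IsTiltingTopology) (hM : G.MemA M) :
    ProjDimLE1 R M :=
  ⟨M, Finsupp.linearCombination R id, Finsupp.linearCombination_id_surjective R M,
    hG.projective_ker hM _ (Finsupp.linearCombination_id_surjective R M)⟩

/-- `φ` is an `𝒜`-cover of `M`. -/
structure IsCover (G : GabrielTopology R) (φ : N →ₗ[R] M) : Prop where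
  memA : G.MemA N
  exists_lift : ∀ (P : Type u) [AddCommGroup P] [Module R P], G.MemA P →
    ∀ f : P →ₗ[R] M, ∃ g : P →ₗ[R] N, φ ∘ₗ g = f
  bijective : ∀ e : N →ₗ[R] N, φ ∘ₗ e = φ → Function.Bijective e

theorem IsACovering.exists_cover (h : G.IsACovering) (M : Type u) [AddCommGroup M] [Module R M] :
    ∃ (C : ModuleCat.{u} R) (φ : C →ₗ[R] M), G.IsCover φ := by
  obtain ⟨C, φ, h1, h2, h3⟩ := h M
  exact ⟨C, φ, h1, h2, h3⟩

namespace IsCover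

variable {φ : N →ₗ[R] M}

theorem surjective (h : G.IsCover φ) : Function.Surjective φ := by
  obtain ⟨g, hg⟩ := h.exists_lift (M →₀ R) memA_of_projective (Finsupp.linearCombination R id)
  intro m
  obtain ⟨x, rfl⟩ := Finsupp.linearCombination_id_surjective R M m
  exact ⟨g x, LinearMap.congr_fun hg x⟩

/-- Wakamatsu's lemma. -/
theorem isDivisible_ker (hG : G.IsTiltingTopology) (h : G.IsCover φ) :
    G.IsDivisible (LinearMap.ker φ) := by
  obtain ⟨T, hT, hdiv⟩ := hG.exists_test
  refine hdiv _ fun E _ _ j q hj hq hjq => ?_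
  have hqj : ∀ b, q (j b) = 0 := fun n => by
    rw [← LinearMap.mem_ker, ← hjq]; exact ⟨n, rfl⟩
  let W : Submodule R (N × E) := LinearMap.range (LinearMap.prod (LinearMap.ker φ).subtype (-j))
  let k : N →ₗ[R] (N × E) ⧸ W := W.mkQ ∘ₗ LinearMap.inl R N E
  have hWq : W ≤ LinearMap.ker (q ∘ₗ LinearMap.snd R N E) := by
    rintro _ ⟨b, rfl⟩; simp [hqj]
  have hWφ : W ≤ LinearMap.ker (φ ∘ₗ LinearMap.fst R N E) := by
    rintro _ ⟨b, rfl⟩; simp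
  let t : ((N × E) ⧸ W) →ₗ[R] T := W.liftQ _ hWq
  let ψ : ((N × E) ⧸ W) →ₗ[R] M := W.liftQ _ hWφ
  have hkj : ∀ b : LinearMap.ker φ, k b = W.mkQ (0, j b) := fun b => by
    rw [← sub_eq_zero]
    simp only [k, LinearMap.comp_apply, ← map_sub, LinearMap.inl_apply]
    rw [Submodule.mkQ_apply, Submodule.Quotient.mk_eq_zero]
    exact ⟨b, by simp⟩
  have hk : Function.Injective k := by
    rw [← LinearMap.ker_eq_bot, LinearMap.ker_eq_bot']
    intro n hn
    rw [LinearMap.comp_apply, Submodule.mkQ_apply, Submodule.Quotient.mk_eq_zero] at hn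
    obtain ⟨b, hb⟩ := hn
    have h1 : (b : N) = n := congrArg Prod.fst hb
    have h2 : -j b = 0 := congrArg Prod.snd hb
    have h3 : b = 0 := hj (by simpa using h2)
    rw [← h1, h3]; rfl
  have ht : Function.Surjective t := fun m => by
    obtain ⟨e, rfl⟩ := hq m
    exact ⟨W.mkQ (0, e), by simp [t]⟩
  have hkt : LinearMap.range k = LinearMap.ker t := by
    apply le_antisymm
    · rintro _ ⟨n, rfl⟩; simp [k, t]
    · intro x hx
      obtain ⟨⟨n, e⟩, rfl⟩ := W.mkQ_surjective x
      have he : e ∈ LinearMap.ker q := by simpa [t] using hx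
      rw [← hjq] at he
      obtain ⟨b, rfl⟩ := he
      refine ⟨n + b, ?_⟩
      rw [map_add, hkj]
      simp [k, ← Submodule.Quotient.mk_add]
  obtain ⟨g, hg⟩ := h.exists_lift _ (h.memA.of_extension hT k t hk ht hkt) ψ
  have hα : φ ∘ₗ (g ∘ₗ k) = φ := by
    rw [← LinearMap.comp_assoc, hg]; ext n; simp [ψ, k]
  let α := LinearEquiv.ofBijective (g ∘ₗ k) (h.bijective _ hα)
  have hα' : ∀ c, φ (α.symm c) = φ c := fun c => by
    conv_rhs => rw [← α.apply_symm_apply c]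
    exact (LinearMap.congr_fun hα (α.symm c)).symm
  let r : E →ₗ[R] LinearMap.ker φ := LinearMap.codRestrict _
    (α.symm.toLinearMap ∘ₗ g ∘ₗ W.mkQ ∘ₗ LinearMap.inr R N E) fun e => by
      rw [LinearMap.mem_ker, LinearMap.comp_apply, LinearEquiv.coe_coe, hα']
      exact (LinearMap.congr_fun hg _).trans (by simp [ψ])
  refine Ext1Vanish.exists_section_of_retraction j q hq hjq r (LinearMap.ext fun b => ?_)
  ext1
  change α.symm (g (W.mkQ (0, j b))) = b
  rw [← hkj, LinearEquiv.symm_apply_eq]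
  rfl

end IsCover
end GabrielTopology

namespace GabrielTopology

variable {R : Type u} [CommRing R] {G : GabrielTopology R}
variable {M N X : Type u} [AddCommGroup M] [Module R M] [AddCommGroup N] [Module R N]
  [AddCommGroup X] [Module R X] {φ : N →ₗ[R] M}

namespace IsCover

theorem exists_retraction (h : G.IsCover φ) (hX : G.MemA X)
    (p : X →ₗ[R] M) (hp : Function.Surjective p) (hD : G.IsDivisible (LinearMap.ker p)) :
    ∃ (i : N →ₗ[R] X) (r : X →ₗ[R] N), (∀ c, p (i c) = φ c) ∧ (∀ x, φ (r x) = p x) ∧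
      ∀ c, r (i c) = c := by
  obtain ⟨i, hi⟩ := h.memA.exists_lift p hp hD φ
  obtain ⟨r, hr⟩ := h.exists_lift X hX p
  have hα : φ ∘ₗ (r ∘ₗ i) = φ := by rw [← LinearMap.comp_assoc, hr, hi]
  let α := LinearEquiv.ofBijective (r ∘ₗ i) (h.bijective _ hα)
  have hα' : ∀ c, φ (α.symm c) = φ c := fun c => by
    conv_rhs => rw [← α.apply_symm_apply c]
    exact (LinearMap.congr_fun hα (α.symm c)).symm
  refine ⟨i, α.symm.toLinearMap ∘ₗ r, LinearMap.congr_fun hi, fun x => ?_, fun c => ?_⟩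
  · exact (hα' _).trans (LinearMap.congr_fun hr x)
  · exact α.symm_apply_apply c

theorem bijective_sub (h : G.IsCover φ) (f : N →ₗ[R] N) (hf : ∀ c, φ (f c) = 0) :
    Function.Bijective (LinearMap.id - f : N →ₗ[R] N) :=
  h.bijective _ (LinearMap.ext fun c => by simp [hf])

theorem eq_zero_of_eq_sum (h : G.IsCover φ) {ι : Type*} [DecidableEq ι] (s : Finset ι) :
    ∀ (y : ι → N) (ε : ι → ι → N →ₗ[R] N), (∀ i j c, φ (ε i j c) = 0) →
      (∀ i ∈ s, y i = ∑ j ∈ s, ε i j (y j)) → ∀ i ∈ s, y i = 0 := by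
  induction s using Finset.induction_on with
  | empty => simp
  | insert a s ha ih =>
    intro y ε hε hy
    let u := LinearEquiv.ofBijective _ (h.bijective_sub (ε a a) (hε a a))
    have hu : ∀ c, u c = c - ε a a c := fun c => rfl
    have hya : y a = u.symm (∑ j ∈ s, ε a j (y j)) := by
      rw [LinearEquiv.eq_symm_apply, hu, sub_eq_iff_eq_add']
      conv_lhs => rw [hy a (Finset.mem_insert_self a s), Finset.sum_insert ha]
    have hs : ∀ i ∈ s, y i = 0 := by
      refine ih y (fun i j => ε i j + ε i a ∘ₗ u.symm.toLinearMap ∘ₗ ε a j) ?_ ?_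
      · intro i j c; simp [hε]
      · intro i hi
        conv_lhs => rw [hy i (Finset.mem_insert_of_mem hi), Finset.sum_insert ha, hya]
        simp [Finset.sum_add_distrib, map_sum, add_comm]
    intro i hi
    rcases Finset.mem_insert.1 hi with rfl | hi
    · rw [hya, Finset.sum_eq_zero, map_zero]
      intro j hj; rw [hs j hj, map_zero]
    · exact hs i hi

theorem isDivisible_ker_mapRange (h : G.IsDivisible (LinearMap.ker φ)) :
    G.IsDivisible (LinearMap.ker (Finsupp.mapRange.linearMap (α := ℕ) φ)) := by
  refine h.finsupp_nat.of_surjective (LinearMap.codRestrict _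
    (Finsupp.mapRange.linearMap (α := ℕ) (LinearMap.ker φ).subtype) fun x => ?_) fun x => ?_
  · ext n; simp
  · have hx : ∀ n, φ (x.1 n) = 0 := fun n => by
      exact DFunLike.congr_fun (LinearMap.mem_ker.1 x.2) n
    refine ⟨Finsupp.ofSupportFinite (fun n => ⟨x.1 n, hx n⟩) ?_, ?_⟩
    · refine x.1.hasFiniteSupport.subset fun n hn => ?_
      rw [Function.mem_support] at hn ⊢
      intro h0
      exact hn (Subtype.ext h0)
    · ext n; rfl

theorem mapRange_bijective (hG : G.IsTiltingTopology) (hcov : G.IsACovering) (h : G.IsCover φ)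
    (e : (ℕ →₀ N) →ₗ[R] (ℕ →₀ N))
    (he : ∀ x, Finsupp.mapRange.linearMap φ (e x) = Finsupp.mapRange.linearMap φ x) :
    Function.Bijective e := by
  obtain ⟨C, φ', h'⟩ := hcov.exists_cover (ℕ →₀ M)
  set ψ := Finsupp.mapRange.linearMap (α := ℕ) φ with hψ
  have hψs : Function.Surjective ψ := fun x => by
    obtain ⟨y, hy⟩ := Finsupp.mapRange_surjective φ (map_zero φ) h.surjective x
    exact ⟨y, hy⟩
  obtain ⟨i, r, hi, hr, hri⟩ := h'.exists_retraction h.memA.finsupp_nat ψ hψs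
    (isDivisible_ker_mapRange (h.isDivisible_ker hG))
  obtain ⟨ε, hε⟩ : ∃ ε : (ℕ →₀ N) →ₗ[R] (ℕ →₀ N), ∀ y, ε y = y - i (r y) :=
    ⟨LinearMap.id - i ∘ₗ r, fun _ => rfl⟩
  have hr0 : ∀ y, r y = 0 → y = 0 := fun y hy => by
    have h0 := h.eq_zero_of_eq_sum y.support y
      (fun m n => Finsupp.lapply m ∘ₗ ε ∘ₗ Finsupp.lsingle n) ?_ ?_
    · ext n
      by_cases hn : n ∈ y.support
      · exact h0 n hn
      · simpa using hn
    · intro m n c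
      have : ψ (ε (Finsupp.single n c)) = 0 := by simp [hε, hi, hr]
      have := DFunLike.congr_fun this m
      simpa [hψ] using this
    · intro m _
      have h1 : y = ∑ n ∈ y.support, Finsupp.single n (y n) := y.sum_single.symm
      have h2 : y = ε y := by simp [hε, hy]
      conv_lhs => rw [h2, h1, map_sum, Finsupp.finsetSum_apply]
      rfl
  have hir : ∀ y, i (r y) = y := fun y => by
    rw [← sub_eq_zero]; exact hr0 _ (by simp [hri])
  have hb := h'.bijective (r ∘ₗ e ∘ₗ i) (LinearMap.ext fun c => by simp [hr, he, hi])
  constructor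
  · intro x y hxy
    rw [← hir x, ← hir y]
    congr 1
    apply hb.1
    simp [hir, hxy]
  · intro x
    obtain ⟨c, hc⟩ := hb.2 (r x)
    refine ⟨i c, ?_⟩
    rw [← hir (e (i c)), ← hir x]
    exact congrArg i hc

theorem exists_pow_smul_eq_zero (hG : G.IsTiltingTopology) (hcov : G.IsACovering)
    (h : G.IsCover φ) (a : R) (ha : ∀ c, φ (a • c) = 0) (c : N) : ∃ n : ℕ, a ^ n • c = 0 := by
  let σ : (ℕ →₀ N) →ₗ[R] (ℕ →₀ N) := Finsupp.lmapDomain N R Nat.succ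
  have hσ0 : ∀ x, σ x 0 = 0 := fun x => Finsupp.mapDomain_of_notMem_range _ _ (by simp)
  have hσ : ∀ x n, σ x (n + 1) = x n := fun x n =>
    Finsupp.mapDomain_apply Nat.succ_injective x n
  obtain ⟨x, hx⟩ := (h.mapRange_bijective hG hcov (LinearMap.id - a • σ) fun x => by
    ext n
    have := ha (σ x n)
    rw [map_smul] at this
    simp [this]).2 (Finsupp.single 0 c)
  have key : ∀ n, x n = a ^ n • c := fun n => by
    induction n with
    | zero =>
      have := DFunLike.congr_fun hx 0
      simpa [hσ0] using this
    | succ n ih =>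
      have := DFunLike.congr_fun hx (n + 1)
      simp only [LinearMap.sub_apply, LinearMap.id_apply, LinearMap.smul_apply, Finsupp.sub_apply,
        Finsupp.smul_apply, hσ] at this
      rw [Finsupp.single_eq_of_ne (by simp), sub_eq_zero] at this
      rw [this, ih, smul_smul, pow_succ']
  obtain ⟨n, hn⟩ := x.support.exists_notMem
  exact ⟨n, by rw [← key]; simpa using hn⟩

end IsCover

theorem IsACovering.memA (hcov : G.IsACovering) (hX : G.MemA X)
    (p : X →ₗ[R] M) (hp : Function.Surjective p) (hD : G.IsDivisible (LinearMap.ker p))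
    (hθ : ∀ b, p b = 0 → ∃ θ : X →ₗ[R] X, (∀ x, p (θ x) = 0) ∧ θ b = b) : G.MemA M := by
  obtain ⟨C, φ, h⟩ := hcov.exists_cover M
  obtain ⟨i, r, hi, hr, hri⟩ := h.exists_retraction hX p hp hD
  have hinj : Function.Injective φ := by
    rw [← LinearMap.ker_eq_bot, LinearMap.ker_eq_bot']
    intro c hc
    obtain ⟨θ, h1, h2⟩ := hθ (i c) (by rw [hi, hc])
    apply (h.bijective_sub (r ∘ₗ θ ∘ₗ i) fun c => by simp [hr, h1]).1
    simp [h2, hri]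
  exact h.memA.of_equiv (LinearEquiv.ofBijective φ ⟨hinj, h.surjective⟩)

end GabrielTopology

namespace GabrielTopology

variable {R : Type u} [CommRing R] {G : GabrielTopology R}
variable {M N X : Type u} [AddCommGroup M] [Module R M] [AddCommGroup N] [Module R N]
  [AddCommGroup X] [Module R X] {Q : Type u} [CommRing Q] [Algebra R Q]

theorem mul_mem {I J : Ideal R} (hI : I ∈ G.sets) (hJ : J ∈ G.sets) : I * J ∈ G.sets := by
  refine G.gabriel _ J hJ fun r hr => G.mem_of_le hI fun a ha => ?_
  rw [Submodule.mem_colon]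
  intro b hb
  rw [smul_eq_mul]
  exact Ideal.mul_mem_mul ha ((Ideal.span_singleton_le_iff_mem J).2 hr hb)

theorem pow_mem {J : Ideal R} (hJ : J ∈ G.sets) (n : ℕ) : J ^ n ∈ G.sets := by
  induction n with
  | zero => rw [pow_zero, Ideal.one_eq_top]; exact G.top_mem
  | succ n ih => exact pow_succ J n ▸ mul_mem ih hJ

theorem IsRingOfQuotients.map_mem_span (hQ : G.IsRingOfQuotients Q) {κ : Type u}
    (P : Submodule R (κ →₀ R)) [Module.Projective R P] (x : κ →₀ R) {I : Ideal R}
    (hI : I ∈ G.sets) (hfg : I.FG) (hx : ∀ r ∈ I, r • x ∈ P) :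
    Finsupp.mapRange.linearMap (Algebra.linearMap R Q) x ∈
      Submodule.span Q (Finsupp.mapRange.linearMap (Algebra.linearMap R Q) '' (P : Set (κ →₀ R))) := by
  classical
  set θ := Finsupp.mapRange.linearMap (α := κ) (Algebra.linearMap R Q) with hθ
  obtain ⟨s, hs⟩ := Module.projective_def.1 (inferInstance : Module.Projective R P)
  let g : I →ₗ[R] (P →₀ R) := s ∘ₗ LinearMap.codRestrict P
    (LinearMap.toSpanSingleton R (κ →₀ R) x ∘ₗ I.subtype) fun r => hx r r.2
  have hg : ∀ r : I, (Finsupp.linearCombination R id (g r) : P) = (r : R) • x := fun r =>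
    congrArg Subtype.val (hs _)
  have : Module.Finite R I := Module.Finite.iff_fg.2 hfg
  obtain ⟨S, hS⟩ := Module.Finite.fg_top (R := R) (M := I)
  let T : Finset P := S.biUnion fun r => (g r).support
  have hT : ∀ r, (g r).support ⊆ T := fun r => by
    have h1 : Submodule.span R (S : Set I) ≤ (Finsupp.supported R R (T : Set P)).comap g := by
      rw [Submodule.span_le]
      intro r hr
      rw [SetLike.mem_coe, Submodule.mem_comap, Finsupp.mem_supported, Finset.coe_subset]
      exact Finset.subset_biUnion_of_mem (fun r => (g r).support) hr
    rw [hS] at h1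
    have h2 := h1 (Submodule.mem_top (x := r))
    rwa [Submodule.mem_comap, Finsupp.mem_supported, Finset.coe_subset] at h2
  choose q hq using fun z : P => hQ.gInjective I hI
    (Algebra.linearMap R Q ∘ₗ Finsupp.lapply z ∘ₗ g)
  have hw : θ x = ∑ z ∈ T, q z • θ z := by
    rw [← sub_eq_zero]
    ext k
    refine hQ.torsionFree _ (G.mem_of_le hI fun r hr => ?_)
    rw [Ideal.mem_torsionOf_iff]
    have h1 : r • θ x = r • ∑ z ∈ T, q z • θ z := by
      rw [← map_smul, ← hg ⟨r, hr⟩, Finsupp.linearCombination_apply,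
        Finsupp.sum_of_support_subset _ (hT _) _ (by simp), Finset.smul_sum]
      rw [AddSubmonoidClass.coe_finsetSum, map_sum]
      refine Finset.sum_congr rfl fun z _ => ?_
      rw [← smul_assoc, ← hq z ⟨r, hr⟩]
      simp
    have h2 := DFunLike.congr_fun h1 k
    simp only [Finsupp.smul_apply] at h2
    rw [Finsupp.sub_apply, smul_sub, h2, sub_self]
  rw [hw]
  exact Submodule.sum_mem _ fun z _ => Submodule.smul_mem _ _
    (Submodule.subset_span ⟨z, z.2, rfl⟩)

theorem IsRingOfQuotients.smul_top_eq_top (hQ : G.IsRingOfQuotients Q)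
    (hG : G.IsTiltingTopology) (hcov : G.IsACovering) {J : Ideal R} (hJ : J ∈ G.sets) :
    J • (⊤ : Submodule R Q) = ⊤ := by
  obtain ⟨J', hJ', hle, hfg⟩ := hG.2.1 J hJ
  suffices h : J' • (⊤ : Submodule R Q) = ⊤ from
    top_le_iff.1 (h.symm.trans_le (Submodule.smul_mono hle le_rfl))
  clear! J
  obtain ⟨C, φ, h⟩ := hcov.exists_cover (R ⧸ J')
  have hann : ∀ c : C, ∃ I ∈ G.sets, I.FG ∧ I ≤ Ideal.torsionOf R C c := fun c => by
    obtain ⟨n, hn⟩ := Ideal.exists_pow_le_of_le_radical_of_fg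
      (I := J') (J := Ideal.torsionOf R C c) (fun a ha => by
        obtain ⟨n, hn⟩ := h.exists_pow_smul_eq_zero hG hcov a (fun c => by
          obtain ⟨b, hb⟩ := Ideal.Quotient.mk_surjective (φ c)
          rw [map_smul, ← hb, Algebra.smul_def, Ideal.Quotient.algebraMap_eq, ← map_mul,
            Ideal.Quotient.eq_zero_iff_mem]
          exact J'.mul_mem_right b ha) c
        exact ⟨n, hn⟩) hfg
    exact ⟨J' ^ n, pow_mem hJ' n, hfg.pow, hn⟩
  obtain ⟨κ, p, hp, hproj⟩ := hG.projDimLE1 h.memA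
  choose f hf using fun k => Ideal.Quotient.mk_surjective (φ (p (Finsupp.single k 1)))
  have hL : ∀ x, Ideal.Quotient.mk J' (Finsupp.linearCombination R f x) = φ (p x) := fun x => by
    have : (Ideal.Quotient.mkₐ R J').toLinearMap ∘ₗ Finsupp.linearCombination R f = φ ∘ₗ p := by
      ext k; simp [hf]
    exact LinearMap.congr_fun this x
  obtain ⟨c, hc⟩ := h.surjective 1
  obtain ⟨x, rfl⟩ := hp c
  obtain ⟨I, hI, hIfg, hIx⟩ := hann (p x)
  have hspan := hQ.map_mem_span (LinearMap.ker p) x hI hIfg fun r hr => by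
    rw [LinearMap.mem_ker, map_smul]; exact hIx hr
  let LQ : (κ →₀ Q) →ₗ[Q] Q := Finsupp.linearCombination Q fun k => algebraMap R Q (f k)
  have hLQ : ∀ x, LQ (Finsupp.mapRange.linearMap (Algebra.linearMap R Q) x) =
      algebraMap R Q (Finsupp.linearCombination R f x) := fun x => by
    induction x using Finsupp.induction_linear with
    | zero => simp
    | add x y hx hy => simp only [map_add, hx, hy]
    | single k r => simp [LQ]
  have h1 : LQ (Finsupp.mapRange.linearMap (Algebra.linearMap R Q) x) ∈
      J'.map (algebraMap R Q) := by
    have := Submodule.mem_map_of_mem (f := LQ) hspan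
    rw [Submodule.map_span] at this
    refine Submodule.span_le.2 ?_ this
    rintro _ ⟨_, ⟨z, hz, rfl⟩, rfl⟩
    rw [hLQ]
    apply Ideal.mem_map_of_mem
    rw [← Ideal.Quotient.eq_zero_iff_mem, hL, LinearMap.mem_ker.1 hz, map_zero]
  rw [hLQ] at h1
  have h2 : Finsupp.linearCombination R f x - 1 ∈ J' := by
    rw [← Ideal.Quotient.eq_zero_iff_mem, map_sub, hL, hc, map_one, sub_self]
  have h3 := sub_mem h1 (Ideal.mem_map_of_mem (algebraMap R Q) h2)
  rw [← map_sub, sub_sub_cancel, map_one] at h3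
  rw [Ideal.smul_top_eq_map, (Ideal.eq_top_iff_one _).2 h3]
  rfl

end GabrielTopology

namespace GabrielTopology

variable {R : Type u} [CommRing R] {G : GabrielTopology R}
variable {Q : Type u} [CommRing Q] [Algebra R Q]

theorem iInf_mem {ι : Type*} [Finite ι] (I : ι → Ideal R) (hI : ∀ i, I i ∈ G.sets) :
    ⨅ i, I i ∈ G.sets := by
  have := Fintype.ofFinite ι
  rw [← Finset.inf_univ_eq_iInf]
  exact Finset.inf_induction G.top_mem (fun _ h _ h' => G.inf_mem h h') fun i _ => hI i

theorem exists_one_eq_sum {J : Ideal R} (hJ : J • (⊤ : Submodule R Q) = ⊤) :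
    ∃ (n : ℕ) (e : Fin n → R) (y : Fin n → Q), (∀ k, e k ∈ J) ∧ ∑ k, e k • y k = 1 := by
  have h1 : (1 : Q) ∈ J.map (algebraMap R Q) := by
    have : (1 : Q) ∈ J • (⊤ : Submodule R Q) := by rw [hJ]; trivial
    rwa [Ideal.smul_top_eq_map] at this
  rw [Ideal.map, Ideal.span, Submodule.mem_span_set'] at h1
  obtain ⟨n, y, g, h⟩ := h1
  choose e he hg using fun k => (g k).2
  refine ⟨n, e, y, he, ?_⟩
  rw [← h]
  refine Finset.sum_congr rfl fun k _ => ?_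
  rw [← hg, Algebra.smul_def, smul_eq_mul, mul_comm]

namespace IsRingOfQuotients

theorem algebraMap_injective (hQ : G.IsRingOfQuotients Q) (hG : G.Faithful) :
    Function.Injective (algebraMap R Q) :=
  (injective_iff_map_eq_zero _).2 fun r hr => hG r (hQ.ker_torsion r hr)

theorem exists_common_denominators (hQ : G.IsRingOfQuotients Q) {ι : Type*} [Finite ι]
    (q : ι → Q) : ∃ I ∈ G.sets, ∀ x ∈ I, ∀ i, ∃ r : R, x • q i = algebraMap R Q r := by
  choose I hI h using fun i => hQ.coker_torsion (q i)
  exact ⟨⨅ i, I i, iInf_mem I hI, fun x hx i => h i x ((iInf_le I i : _) hx)⟩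

theorem isPerfectLocalization (hQ : G.IsRingOfQuotients Q) (hG : G.Faithful)
    (h : ∀ J ∈ G.sets, J • (⊤ : Submodule R Q) = ⊤) : G.IsPerfectLocalization Q := by
  have hinj := hQ.algebraMap_injective hG
  refine ⟨Module.Flat.of_forall_isTrivialRelation fun {l f x} hfx => ?_, fun S _ f g hfg => ?_,
    fun J => ⟨h J, fun hJ => ?_⟩⟩
  · obtain ⟨I, hI, hIx⟩ := hQ.exists_common_denominators x
    obtain ⟨n, e, y, he, hey⟩ := exists_one_eq_sum (h I hI)
    choose a ha using fun i k => hIx (e k) (he k) i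
    refine ⟨n, a, y, fun i => ?_, fun k => hinj ?_⟩
    · rw [← one_mul (x i), ← hey, Finset.sum_mul]
      refine Finset.sum_congr rfl fun k _ => ?_
      rw [Algebra.smul_def (a i k), ← ha, smul_mul_assoc, smul_mul_assoc, mul_comm]
    · rw [map_sum, map_zero, ← smul_zero (e k), ← hfx, Finset.smul_sum]
      refine Finset.sum_congr rfl fun i _ => ?_
      rw [map_mul, ← ha, smul_comm, Algebra.smul_def (f i)]
  · ext q
    obtain ⟨I, hI, hIq⟩ := hQ.coker_torsion q
    obtain ⟨n, e, y, he, hey⟩ := exists_one_eq_sum (h I hI)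
    have hfg' : ∀ r, f (algebraMap R Q r) = g (algebraMap R Q r) := RingHom.congr_fun hfg
    have hk : ∀ k, f q * g (e k • y k) = g q * g (e k • y k) := fun k => by
      obtain ⟨r, hr⟩ := hIq (e k) (he k)
      rw [Algebra.smul_def] at hr
      rw [Algebra.smul_def, map_mul, ← mul_assoc, ← mul_assoc, ← hfg', ← map_mul, mul_comm q, hr,
        hfg' r, ← hr, map_mul, mul_comm (g q), hfg']
    rw [← mul_one (f q), ← mul_one (g q), ← map_one g, ← hey, map_sum, Finset.mul_sum,
      Finset.mul_sum]
    exact Finset.sum_congr rfl fun k _ => hk k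
  · obtain ⟨n, e, y, he, hey⟩ := exists_one_eq_sum hJ
    obtain ⟨I, hI, hIy⟩ := hQ.exists_common_denominators y
    refine G.mem_of_le hI fun r hr => ?_
    choose a ha using hIy r hr
    have : r = ∑ k, e k * a k := hinj <| by
      rw [map_sum, ← mul_one (algebraMap R Q r), ← hey, Finset.mul_sum]
      refine Finset.sum_congr rfl fun k _ => ?_
      rw [map_mul, ← ha, Algebra.smul_def, Algebra.smul_def]; ring
    rw [this]
    exact Ideal.sum_mem _ fun k _ => J.mul_mem_right _ (he k)

end IsRingOfQuotients
end GabrielTopology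

/-- Villamayor's criterion. -/
theorem Module.Flat.exists_endomorphism {R : Type*} [CommRing R] {M κ : Type*} [AddCommGroup M]
    [Module R M] [Module.Flat R M] (p : (κ →₀ R) →ₗ[R] M) (hp : Function.Surjective p)
    (S : Finset (κ →₀ R)) (hS : ∀ z ∈ S, p z = 0) :
    ∃ θ : (κ →₀ R) →ₗ[R] (κ →₀ R), (∀ x, p (θ x) = 0) ∧ ∀ z ∈ S, θ z = z := by
  classical
  let T : Set κ := (S.biUnion Finsupp.support : Finset κ)
  let res : (κ →₀ R) →ₗ[R] (T →₀ R) := Finsupp.lsubtypeDomain T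
  let emb : (T →₀ R) →ₗ[R] (κ →₀ R) := Finsupp.lmapDomain R R Subtype.val
  have hT : ∀ z ∈ S, emb (res z) = z := fun z hz => by
    ext k
    by_cases hk : k ∈ T
    · exact (Finsupp.mapDomain_apply Subtype.val_injective _ (⟨k, hk⟩ : T)).trans rfl
    · rw [show z k = 0 by
        by_contra h
        exact hk (Finset.mem_biUnion.2 ⟨z, hz, Finsupp.mem_support_iff.2 h⟩)]
      exact Finsupp.mapDomain_of_notMem_range _ _ (by simpa using hk)
  have : Finite T := Finset.finite_toSet _
  obtain ⟨k, a, y, hya, haf⟩ := Module.Flat.exists_factorization_of_comp_eq_zero_of_free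
    (f := Finsupp.linearCombination R fun z : S => res z) (x := p ∘ₗ emb) <| by
      ext ⟨z, hz⟩
      simp [hT z hz, hS z hz]
  obtain ⟨y', hy'⟩ := Module.projective_lifting_property p y hp
  refine ⟨(emb - y' ∘ₗ a) ∘ₗ res, fun x => ?_, fun z hz => ?_⟩
  · have h1 := LinearMap.congr_fun hya (res x)
    have h2 := LinearMap.congr_fun hy' (a (res x))
    simp only [LinearMap.comp_apply] at h1 h2
    simp [h1, h2]
  · have h1 := LinearMap.congr_fun haf (Finsupp.single ⟨z, hz⟩ 1)
    simp only [LinearMap.comp_apply, Finsupp.linearCombination_single, one_smul,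
      LinearMap.zero_apply] at h1
    simp [h1, hT z hz]

namespace GabrielTopology

variable {R : Type u} [CommRing R] {G : GabrielTopology R}
variable {M N X : Type u} [AddCommGroup M] [Module R M] [AddCommGroup N] [Module R N]
  [AddCommGroup X] [Module R X] {Q : Type u} [CommRing Q] [Algebra R Q]

open TensorProduct in
theorem IsACovering.memA_tensor_of_endomorphisms (hcov : G.IsACovering) {F : Type u}
    [AddCommGroup F] [Module R F] (hF : G.MemA (F ⊗[R] X)) (hD : G.IsDivisible X)
    (p : F →ₗ[R] M) (hp : Function.Surjective p)
    (hθ : ∀ S : Finset F, (∀ z ∈ S, p z = 0) →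
      ∃ θ : F →ₗ[R] F, (∀ x, p (θ x) = 0) ∧ ∀ z ∈ S, θ z = z) : G.MemA (M ⊗[R] X) := by
  have hex : Function.Exact ((LinearMap.ker p).subtype.rTensor X) (p.rTensor X) :=
    rTensor_exact X (LinearMap.exact_subtype_ker_map p) hp
  refine hcov.memA hF (p.rTensor X) (LinearMap.rTensor_surjective X hp) ?_ fun b hb => ?_
  · rw [hex.linearMap_ker_eq]
    exact hD.tensor.range _
  · obtain ⟨b, rfl⟩ := (hex b).1 hb
    obtain ⟨S, rfl⟩ := TensorProduct.exists_finset b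
    classical
    obtain ⟨θ, h1, h2⟩ := hθ (S.image fun i => (i.1 : F)) fun z hz => by
        obtain ⟨i, -, rfl⟩ := Finset.mem_image.1 hz
        exact i.1.2
    refine ⟨θ.rTensor X, fun x => ?_, ?_⟩
    · rw [← LinearMap.comp_apply, ← LinearMap.rTensor_comp, show p ∘ₗ θ = 0 from LinearMap.ext h1,
        LinearMap.rTensor_zero, LinearMap.zero_apply]
    · simp only [map_sum, LinearMap.rTensor_tmul, Submodule.subtype_apply]
      refine Finset.sum_congr rfl fun i hi => ?_
      rw [h2 _ (Finset.mem_image_of_mem _ hi)]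

open TensorProduct in
open scoped Classical in
theorem IsACovering.memA_tensor (hcov : G.IsACovering) [Module.Flat R M] (hX : G.MemA X)
    (hD : G.IsDivisible X) : G.MemA (M ⊗[R] X) :=
  hcov.memA_tensor_of_endomorphisms
    ((hX.finsupp M).of_equiv (TensorProduct.finsuppScalarLeft R X M).symm) hD
    (Finsupp.linearCombination R id) (Finsupp.linearCombination_id_surjective R M)
    (Module.Flat.exists_endomorphism _ (Finsupp.linearCombination_id_surjective R M))

end GabrielTopology

namespace GabrielTopology

variable {R : Type u} [CommRing R] {G : GabrielTopology R} {Q : Type u} [CommRing Q] [Algebra R Q]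
variable {M N : Type u} [AddCommGroup M] [Module R M] [Module Q M] [IsScalarTower R Q M]
  [AddCommGroup N] [Module R N] [Module Q N] [IsScalarTower R Q N]

theorem isDivisible_of_isScalarTower (Q : Type u) [CommRing Q] [Algebra R Q] [Module Q M]
    [IsScalarTower R Q M] (h : ∀ J ∈ G.sets, J • (⊤ : Submodule R Q) = ⊤) :
    G.IsDivisible M := fun J hJ => by
  obtain ⟨n, e, y, he, hey⟩ := exists_one_eq_sum (h J hJ)
  rw [eq_top_iff]
  rintro m -
  rw [← one_smul Q m, ← hey, Finset.sum_smul]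
  refine Submodule.sum_mem _ fun k _ => ?_
  rw [smul_assoc]
  exact Submodule.smul_mem_smul (he k) trivial

theorem IsRingOfQuotients.linearMap_map_smul (hQ : G.IsRingOfQuotients Q)
    (h : ∀ J ∈ G.sets, J • (⊤ : Submodule R Q) = ⊤) (s : M →ₗ[R] N) (q : Q) (m : M) :
    s (q • m) = q • s m := by
  obtain ⟨I, hI, hIq⟩ := hQ.coker_torsion q
  obtain ⟨n, e, y, he, hey⟩ := exists_one_eq_sum (h I hI)
  have key : ∀ k, (e k • y k) • s (q • m) = (e k • y k) • q • s m := fun k => by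
    obtain ⟨r, hr⟩ := hIq (e k) (he k)
    have h1 : e k • q • m = r • m := by rw [← smul_assoc, hr, algebraMap_smul]
    have h2 : e k • q • s m = r • s m := by rw [← smul_assoc, hr, algebraMap_smul]
    rw [smul_assoc, smul_assoc, ← smul_comm (y k), ← smul_comm (y k), ← s.map_smul, h1, h2,
      s.map_smul]
  rw [← one_smul Q (s (q • m)), ← one_smul Q (q • s m), ← hey, Finset.sum_smul, Finset.sum_smul]
  exact Finset.sum_congr rfl fun k _ => key k

theorem IsACovering.memA_of_flat (hG : G.IsTiltingTopology) (hcov : G.IsACovering)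
    (h : ∀ J ∈ G.sets, J • (⊤ : Submodule R Q) = ⊤) [Module.Flat R M] : G.MemA M := by
  obtain ⟨X, Y, i, p, hX, hXD, hY, -, hi, hp, hip⟩ := hG.exists_preenvelope
  obtain ⟨g, hg⟩ := (hY Q (isDivisible_of_isScalarTower Q h)).exists_extend i p hi hp hip
    (Algebra.linearMap R Q)
  have hg1 : g (i 1) = 1 := (LinearMap.congr_fun hg 1).trans (map_one (algebraMap R Q))
  refine (hcov.memA_tensor (M := M) hX hXD).of_retract
    ((TensorProduct.mk R M X).flip (i 1))
    (TensorProduct.lift ((Algebra.lsmul R R M : Q →ₐ[R] Module.End R M).toLinearMap ∘ₗ g).flip) ?_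
  ext m
  simp [hg1]

theorem IsRingOfQuotients.isPerfectRing (hQ : G.IsRingOfQuotients Q) (hG : G.IsTiltingTopology)
    (hcov : G.IsACovering) (h : ∀ J ∈ G.sets, J • (⊤ : Submodule R Q) = ⊤) [Module.Flat R Q] :
    IsPerfectRing Q := by
  intro M _ _ hM
  let _ : Module R M := Module.compHom M (algebraMap R Q)
  have : IsScalarTower R Q M := IsScalarTower.of_algebraMap_smul fun r x => rfl
  have : Module.Flat R M := Module.Flat.trans R Q M
  have hp := Finsupp.linearCombination_id_surjective Q M
  generalize Finsupp.linearCombination Q (id : M → M) = p at hp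
  have hD : G.IsDivisible (LinearMap.ker (p.restrictScalars R)) :=
    (isDivisible_of_isScalarTower (M := LinearMap.ker p) Q h).of_surjective
      (LinearMap.codRestrict _ ((LinearMap.ker p).subtype.restrictScalars R) fun x => x.2)
      fun x => ⟨⟨x.1, x.2⟩, rfl⟩
  obtain ⟨s, hs⟩ := (hcov.memA_of_flat (M := M) hG h).exists_lift (p.restrictScalars R) hp hD
    LinearMap.id
  exact Module.Projective.of_split
    { toFun := s, map_add' := map_add s, map_smul' := hQ.linearMap_map_smul h s } p
    (LinearMap.ext fun m => LinearMap.congr_fun hs m)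

end GabrielTopology

namespace GabrielTopology

variable {R : Type u} [CommRing R] {G : GabrielTopology R}
variable {Y : Type u} [AddCommGroup Y] [Module R Y]

/-- The weighted shift of `Y^(ℕ)` with weights `r`. -/
noncomputable def weightedShift (r : ℕ → R) (Y : Type u) [AddCommGroup Y] [Module R Y] :
    (ℕ →₀ Y) →ₗ[R] (ℕ →₀ Y) :=
  Finsupp.lsum R fun n => r n • Finsupp.lsingle (n + 1)

theorem weightedShift_single (r : ℕ → R) (n : ℕ) (y : Y) :
    weightedShift r Y (Finsupp.single n y) = Finsupp.single (n + 1) (r n • y) := by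
  simp [weightedShift]

theorem weightedShift_zero (r : ℕ → R) (x : ℕ →₀ Y) : weightedShift r Y x 0 = 0 := by
  induction x using Finsupp.induction_linear with
  | zero => simp
  | add x y hx hy => simp [hx, hy]
  | single n y => simp [weightedShift_single]

theorem weightedShift_succ (r : ℕ → R) (x : ℕ →₀ Y) (k : ℕ) :
    weightedShift r Y x (k + 1) = r k • x k := by
  induction x using Finsupp.induction_linear with
  | zero => simp
  | add x y hx hy => simp [hx, hy]
  | single n y =>
    rw [weightedShift_single]
    by_cases h : n = k
    · subst h; simp
    · rw [Finsupp.single_eq_of_ne (by omega), Finsupp.single_eq_of_ne (by omega), smul_zero]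

/-- The coordinates of the inverse of `1 - weightedShift r Y`, with values in `Y^ℕ`. -/
noncomputable def shiftResolvent (r : ℕ → R) (Y : Type u) [AddCommGroup Y] [Module R Y] :
    ℕ → (ℕ →₀ Y) →ₗ[R] Y
  | 0 => Finsupp.lapply 0
  | k + 1 => Finsupp.lapply (k + 1) + r k • shiftResolvent r Y k

theorem shiftResolvent_apply (r : ℕ → R) (x : ℕ →₀ Y) (k : ℕ) :
    shiftResolvent r Y k (x - weightedShift r Y x) = x k := by
  induction k with
  | zero => simp [shiftResolvent, weightedShift_zero]
  | succ k ih =>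
    rw [shiftResolvent, LinearMap.add_apply, LinearMap.smul_apply, ih]
    simp [weightedShift_succ]

theorem IsACovering.exists_shift_retraction (hcov : G.IsACovering) (hY : G.MemA Y)
    (hD : G.IsDivisible Y) (r : ℕ → R) :
    ∃ ρ : (ℕ →₀ Y) →ₗ[R] (ℕ →₀ Y), ∀ x, ρ (x - weightedShift r Y x) = x := by
  obtain ⟨τ, hτ⟩ : ∃ τ : (ℕ →₀ Y) →ₗ[R] (ℕ →₀ Y), ∀ x, τ x = x - weightedShift r Y x :=
    ⟨LinearMap.id - weightedShift r Y, fun _ => rfl⟩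
  have hτi : Function.Injective τ := fun x y hxy => by
    ext k
    rw [← shiftResolvent_apply r x, ← shiftResolvent_apply r y, ← hτ, ← hτ, hxy]
  have hN : G.MemA ((ℕ →₀ Y) ⧸ LinearMap.range τ) := by
    refine hcov.memA hY.finsupp_nat (LinearMap.range τ).mkQ (Submodule.mkQ_surjective _) ?_
      fun b hb => ?_
    · rw [Submodule.ker_mkQ]
      exact hD.finsupp_nat.range τ
    · rw [← LinearMap.mem_ker, Submodule.ker_mkQ] at hb
      obtain ⟨x, rfl⟩ := hb
      refine ⟨τ ∘ₗ ∑ k ∈ x.support, Finsupp.lsingle k ∘ₗ shiftResolvent r Y k, fun y => ?_, ?_⟩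
      · rw [← LinearMap.mem_ker, Submodule.ker_mkQ]
        exact ⟨_, rfl⟩
      · rw [LinearMap.comp_apply]
        congr 1
        rw [hτ]
        simp only [LinearMap.sum_apply, LinearMap.comp_apply, shiftResolvent_apply]
        exact x.sum_single
  obtain ⟨ρ, hρ⟩ := (hN _ hD.finsupp_nat).exists_extend τ (LinearMap.range τ).mkQ hτi
    (Submodule.mkQ_surjective _) (Submodule.ker_mkQ _).symm LinearMap.id
  exact ⟨ρ, fun x => by rw [← hτ]; exact LinearMap.congr_fun hρ x⟩

theorem IsACovering.exists_prod_smul_eq (hcov : G.IsACovering) (hY : G.MemA Y)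
    (hD : G.IsDivisible Y) (r : ℕ → R) :
    ∃ B : ℕ → ℕ → Y →ₗ[R] Y, ∀ y, ∃ m₀, ∀ m ≥ m₀, ∀ n > m,
      (∏ i ∈ Finset.range m, r i) • y = (∏ i ∈ Finset.range n, r i) • B m n y := by
  obtain ⟨ρ, hρ⟩ := hcov.exists_shift_retraction hY hD r
  have hstep : ∀ n y, ρ (Finsupp.single n y) =
      Finsupp.single n y + r n • ρ (Finsupp.single (n + 1) y) := fun n y => by
    have := hρ (Finsupp.single n y)
    rw [map_sub, weightedShift_single, ← Finsupp.smul_single, map_smul, sub_eq_iff_eq_add] at this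
    exact this
  have hP : ∀ m n y, ρ (Finsupp.single 0 y) m =
      (if m < n then (∏ i ∈ Finset.range m, r i) • y else 0) +
        (∏ i ∈ Finset.range n, r i) • ρ (Finsupp.single n y) m := fun m n y => by
    induction n with
    | zero => simp
    | succ n ih =>
      rw [ih, hstep n, Finsupp.add_apply, smul_add, ← add_assoc, Finset.prod_range_succ, mul_smul,
        Finsupp.smul_apply]
      congr 1
      rcases lt_trichotomy m n with h | rfl | h
      · rw [if_pos h, if_pos (by omega), Finsupp.single_eq_of_ne h.ne, smul_zero, add_zero]
      · simp
      · rw [if_neg (by omega), if_neg (by omega), Finsupp.single_eq_of_ne h.ne', smul_zero,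
          add_zero]
  refine ⟨fun m n => -(Finsupp.lapply m ∘ₗ ρ ∘ₗ Finsupp.lsingle n), fun y => ?_⟩
  refine ⟨(ρ (Finsupp.single 0 y)).support.sup id + 1, fun m hm n hn => ?_⟩
  have h0 : ρ (Finsupp.single 0 y) m = 0 := by
    by_contra h
    have := Finset.le_sup (f := id) (Finsupp.mem_support_iff.2 h)
    simp only [id] at this
    omega
  have := hP m n y
  rw [h0, if_pos hn] at this
  rw [LinearMap.neg_apply, smul_neg]
  exact eq_neg_of_add_eq_zero_left this.symm

theorem IsACovering.exists_prod_sub_mem (hG : G.IsTiltingTopology) (hcov : G.IsACovering)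
    {J : Ideal R} (hJ : J ∈ G.sets) (r : ℕ → R) :
    ∃ m, ∀ n > m, ∃ w,
      ∏ i ∈ Finset.range m, r i - (∏ i ∈ Finset.range n, r i) * w ∈ J := by
  obtain ⟨X, Y, i, p, -, hXD, hY, hYD, hi, hp, hip⟩ := hG.exists_preenvelope
  obtain ⟨B, hB⟩ := hcov.exists_prod_smul_eq hY hYD r
  obtain ⟨P, hP⟩ : ∃ P : ℕ → R, ∀ n, ∏ i ∈ Finset.range n, r i = P n := ⟨_, fun _ => rfl⟩
  simp only [hP] at hB ⊢
  have hpi : ∀ x, p x = 0 → ∃ z, i z = x := fun x hx => by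
    rw [← LinearMap.mem_ker, ← hip] at hx
    exact hx
  have hpi' : ∀ z, p (i z) = 0 := fun z => by
    rw [← LinearMap.mem_ker, ← hip]
    exact ⟨z, rfl⟩
  have key : ∀ x ∈ J • (⊤ : Submodule R X), ∃ m₀, ∀ m ≥ m₀, ∀ n > m, ∃ v, ∃ z ∈ J,
      P m • x = P n • v + i z ∧ p v = B m n (p x) := fun x hx => by
    induction hx using Submodule.smul_induction_on' with
    | smul a ha t _ =>
      obtain ⟨m₀, h⟩ := hB (p t)
      refine ⟨m₀, fun m hm n hn => ?_⟩
      obtain ⟨v, hv⟩ := hp (B m n (p t))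
      obtain ⟨z, hz⟩ := hpi (P m • t - P n • v) (by
        rw [map_sub, map_smul, map_smul, hv, sub_eq_zero]; exact h m hm n hn)
      refine ⟨a • v, a * z, J.mul_mem_right z ha, ?_, by rw [map_smul, map_smul, map_smul, hv]⟩
      rw [← smul_eq_mul, map_smul, hz, smul_sub, smul_comm (P n), smul_comm (P m)]
      abel
    | add x _ y _ hx hy =>
      obtain ⟨m₁, h₁⟩ := hx
      obtain ⟨m₂, h₂⟩ := hy
      refine ⟨max m₁ m₂, fun m hm n hn => ?_⟩
      obtain ⟨v, z, hz, hv, hv'⟩ := h₁ m (le_of_max_le_left hm) n hn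
      obtain ⟨w, z', hz', hw, hw'⟩ := h₂ m (le_of_max_le_right hm) n hn
      refine ⟨v + w, z + z', add_mem hz hz', ?_, by simp only [map_add, hv', hw']⟩
      rw [smul_add, hv, hw, smul_add, map_add]
      abel
  obtain ⟨m, h⟩ := key (i 1) (by rw [hXD J hJ]; trivial)
  refine ⟨m, fun n hn => ?_⟩
  obtain ⟨v, z, hz, hv, hv'⟩ := h m le_rfl n hn
  obtain ⟨w, rfl⟩ := hpi v (by rw [hv', hpi', map_zero])
  refine ⟨w, ?_⟩
  have : P m = P n * w + z := hi <| by
    rw [map_add, ← smul_eq_mul, map_smul, ← hv, ← map_smul, smul_eq_mul, mul_one]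
  rw [this, add_sub_cancel_left]
  exact hz

end GabrielTopology

/-- The descending chain condition on principal ideals. -/
def PrincipalDCC (S : Type*) [CommRing S] : Prop :=
  ∀ a : ℕ → S, ∃ m, ∀ n > m, ∏ i ∈ Finset.range n, a i ∣ ∏ i ∈ Finset.range m, a i

namespace PrincipalDCC

variable {S : Type*} [CommRing S]

theorem of_surjective {S' : Type*} [CommRing S'] (h : PrincipalDCC S) (f : S →+* S')
    (hf : Function.Surjective f) : PrincipalDCC S' := fun a => by
  choose b hb using fun i => hf (a i)
  obtain ⟨m, hm⟩ := h b
  exact ⟨m, fun n hn => by simpa [hb] using map_dvd f (hm n hn)⟩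

theorem exists_idempotent (h : PrincipalDCC S) (a : S) :
    IsUnit a ∨ ∃ m b, IsIdempotentElem (a ^ (m + 1) * b) ∧
      a ^ (m + 1) = a ^ (m + 1) * (a ^ (m + 1) * b) := by
  obtain ⟨m, hm⟩ := h fun _ => a
  obtain ⟨c, hc⟩ := hm (2 * m + 1) (by omega)
  simp only [Finset.prod_const, Finset.card_range] at hc
  rcases m with - | m
  · left
    exact .of_mul_eq_one c (by simpa using hc.symm)
  · right
    have h1 : a ^ (m + 1) = a ^ (m + 1) * (a ^ (m + 1) * (a * c)) := by
      conv_lhs => rw [hc]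
      ring
    refine ⟨m, a * c, ?_, h1⟩
    rw [IsIdempotentElem, mul_right_comm, ← h1]

theorem isLocalRing [Nontrivial S] (h : PrincipalDCC S)
    (hS : ∀ e : S, IsIdempotentElem e → e = 0 ∨ e = 1) : IsLocalRing S := by
  refine IsLocalRing.of_isUnit_or_isUnit_one_sub_self fun a => ?_
  obtain ha | ⟨m, b, he, hab⟩ := h.exists_idempotent a
  · exact .inl ha
  · rcases hS _ he with h0 | h1
    · rw [h0, mul_zero] at hab
      exact .inr (IsNilpotent.isUnit_one_sub ⟨m + 1, hab⟩)
    · exact .inl (.of_mul_eq_one (a ^ m * b) (by rw [← h1]; ring))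

theorem prod_eq_zero [IsLocalRing S] (h : PrincipalDCC S) (a : ℕ → S)
    (ha : ∀ n, a n ∈ IsLocalRing.maximalIdeal S) : ∃ n, ∏ i ∈ Finset.range n, a i = 0 := by
  obtain ⟨m, hm⟩ := h a
  obtain ⟨c, hc⟩ := hm (m + 1) (by omega)
  rw [Finset.prod_range_succ] at hc
  refine ⟨m, ?_⟩
  have hu : IsUnit (1 - a m * c) := by
    by_contra hu
    have h1 : 1 - a m * c + a m * c ∈ IsLocalRing.maximalIdeal S :=
      add_mem ((IsLocalRing.mem_maximalIdeal _).2 hu) (Ideal.mul_mem_right c _ (ha m))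
    rw [sub_add_cancel] at h1
    exact (Ideal.ne_top_iff_one _).1 (IsLocalRing.maximalIdeal.isMaximal S).ne_top h1
  rw [← hu.mul_left_eq_zero, mul_sub, mul_one, ← mul_assoc, ← hc, sub_self]

/-- Nakayama's lemma for a local ring with T-nilpotent maximal ideal. -/
theorem subsingleton_of_smul_top [IsLocalRing S] (h : PrincipalDCC S) {W : Type*}
    [AddCommGroup W] [Module S W]
    (hW : IsLocalRing.maximalIdeal S • (⊤ : Submodule S W) = ⊤) : Subsingleton W := by
  by_contra hne
  rw [not_subsingleton_iff_nontrivial] at hne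
  have step : ∀ P : {P : S // ∃ w : W, P • w ≠ 0},
      ∃ a ∈ IsLocalRing.maximalIdeal S, ∃ w : W, (P.1 * a) • w ≠ 0 := by
    rintro ⟨P, w, hw⟩
    by_contra! hcon
    have hz : IsLocalRing.maximalIdeal S • (⊤ : Submodule S W) ≤
        LinearMap.ker (LinearMap.lsmul S W P) :=
      Submodule.smul_le.2 fun a ha t _ => by simpa [smul_smul, mul_comm] using hcon a ha t
    rw [hW] at hz
    exact hw (hz (Submodule.mem_top (x := w)))
  choose a ha ha' using step
  obtain ⟨w, hw⟩ := exists_ne (0 : W)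
  let s : ℕ → {P : S // ∃ w : W, P • w ≠ 0} := fun n =>
    Nat.rec ⟨1, w, by rwa [one_smul]⟩ (fun _ P => ⟨P.1 * a P, ha' P⟩) n
  have hs : ∀ n, (s n).1 = ∏ i ∈ Finset.range n, a (s i) := fun n => by
    induction n with
    | zero => rfl
    | succ n ih => rw [Finset.prod_range_succ, ← ih]
  obtain ⟨n, hn⟩ := h.prod_eq_zero (fun i => a (s i)) fun i => ha _
  obtain ⟨v, hv⟩ := (s n).2
  rw [hs, hn, zero_smul] at hv
  exact hv rfl

open IsLocalRing in
theorem free_of_flat {S : Type u} [CommRing S] [IsLocalRing S] (h : PrincipalDCC S)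
    (M : Type u) [AddCommGroup M] [Module S M] [Module.Flat S M] : Module.Free S M := by
  let w := Module.Free.chooseBasis (ResidueField S) (TensorProduct S (ResidueField S) M)
  have hsurj := TensorProduct.mk_surjective S M (ResidueField S) Ideal.Quotient.mk_surjective
  obtain ⟨v, hv⟩ := hsurj.comp_left w
  replace hv : TensorProduct.mk S (ResidueField S) M 1 ∘ v = w := hv
  refine .of_basis (.mk (Module.IsLocalRing.linearIndependent_of_flat v
    (hv ▸ w.linearIndependent)) ?_)
  set N := Submodule.span S (Set.range v) with hN
  have hmap : N.map (TensorProduct.mk S (ResidueField S) M 1) = ⊤ := by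
    rw [hN, Submodule.map_span, ← Submodule.restrictScalars_span S (ResidueField S)
      Ideal.Quotient.mk_surjective, Submodule.restrictScalars_eq_top_iff, ← w.span_eq,
      ← Set.range_comp, hv]
  have hsup : N ⊔ maximalIdeal S • ⊤ = ⊤ := by
    rw [← LinearMap.ker_tensorProductMk (Q := M), ← Submodule.comap_map_eq]
    exact (congrArg (Submodule.comap _) hmap).trans (Submodule.comap_top _)
  have := h.subsingleton_of_smul_top (W := M ⧸ N) (by
    have := congrArg (Submodule.map N.mkQ) hsup
    rwa [Submodule.map_sup, Submodule.map_smul'', Submodule.map_top, Submodule.range_mkQ,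
      Submodule.mkQ_map_self, bot_sup_eq] at this)
  rw [Submodule.Quotient.subsingleton_iff] at this
  exact this.ge

end PrincipalDCC

/-- On every flat module, multiplication by `e` factors through a projective module. -/
def FlatSMulFactors (S : Type u) [CommRing S] (e : S) : Prop :=
  ∀ (M : Type u) [AddCommGroup M] [Module S M], Module.Flat S M →
    ∃ (P : Type u) (_ : AddCommGroup P) (_ : Module S P), Module.Projective S P ∧
      ∃ (α : M →ₗ[S] P) (β : P →ₗ[S] M), β ∘ₗ α = e • LinearMap.id

namespace FlatSMulFactors

variable {S : Type u} [CommRing S]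

theorem add {f g : S} (hf : FlatSMulFactors S f) (hg : FlatSMulFactors S g) :
    FlatSMulFactors S (f + g) := fun M _ _ hM => by
  obtain ⟨P, _, _, _, α, β, h⟩ := hf M hM
  obtain ⟨P', _, _, _, α', β', h'⟩ := hg M hM
  exact ⟨P × P', inferInstance, inferInstance, inferInstance, α.prod α', β.coprod β', by
    rw [LinearMap.coprod_comp_prod, h, h', add_smul]⟩

open TensorProduct in
theorem of_primitive (hS : PrincipalDCC S) {e : S} (he : IsIdempotentElem e)
    (hprim : ∀ f, IsIdempotentElem f → f * e = f → f = 0 ∨ f = e) : FlatSMulFactors S e := by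
  by_cases h0 : e = 0
  · exact fun M _ _ _ => ⟨PUnit, inferInstance, inferInstance, inferInstance, 0, 0, by
      simp [h0]⟩
  let I : Ideal S := Ideal.span {1 - e}
  have hI : ∀ x ∈ I, e * x = 0 := fun x hx => by
    obtain ⟨y, rfl⟩ := Ideal.mem_span_singleton'.1 hx
    linear_combination -y * he.eq
  have hIe : ∀ x : S, x - e * x ∈ I := fun x =>
    Ideal.mem_span_singleton'.2 ⟨x, by ring⟩
  have : Nontrivial (S ⧸ I) := Ideal.Quotient.nontrivial_iff.2 fun h => h0 (by
    have := hI 1 (h ▸ Submodule.mem_top)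
    rwa [mul_one] at this)
  have hdcc : PrincipalDCC (S ⧸ I) := hS.of_surjective _ Ideal.Quotient.mk_surjective
  have : IsLocalRing (S ⧸ I) := hdcc.isLocalRing fun x hx => by
    obtain ⟨x, rfl⟩ := Ideal.Quotient.mk_surjective x
    have hmk : Ideal.Quotient.mk I x = Ideal.Quotient.mk I (e * x) :=
      Ideal.Quotient.eq.2 (hIe x)
    have hsq : e * (x * x - x) = 0 := hI _ (Ideal.Quotient.eq.1 (by simpa using hx.eq))
    rcases hprim (e * x) (by
      change e * x * (e * x) = e * x
      linear_combination x * x * he.eq + hsq) (by linear_combination x * he.eq) with h | h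
    · exact .inl (by rw [hmk, h, map_zero])
    · refine .inr ?_
      rw [hmk, h, ← map_one (Ideal.Quotient.mk I), eq_comm, Ideal.Quotient.eq]
      simpa using hIe 1
  let sec : (S ⧸ I) →ₗ[S] S := Submodule.liftQ I (LinearMap.lsmul S S e) hI
  have : Module.Projective S (S ⧸ I) := .of_split sec I.mkQ (by
    refine Submodule.linearMap_qext _ (LinearMap.ext fun x => ?_)
    exact (Ideal.Quotient.eq.2 (hIe x)).symm)
  classical
  intro M _ _ hM
  have := hdcc.free_of_flat ((S ⧸ I) ⊗[S] M)
  let b := Module.Free.chooseBasis (S ⧸ I) ((S ⧸ I) ⊗[S] M)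
  refine ⟨(S ⧸ I) ⊗[S] M, inferInstance, inferInstance,
    .of_equiv (b.repr.restrictScalars S ≪≫ₗ finsuppLequivDFinsupp S).symm, TensorProduct.mk S (S ⧸ I) M 1,
    TensorProduct.lift (LinearMap.lsmul S M ∘ₗ sec), LinearMap.ext fun m => ?_⟩
  change (e * 1) • m = e • m
  rw [mul_one]

theorem one (hS : PrincipalDCC S) : FlatSMulFactors S 1 := by
  by_contra h1
  have step : ∀ e : {e : S // IsIdempotentElem e ∧ ¬ FlatSMulFactors S e},
      ∃ g : {e : S // IsIdempotentElem e ∧ ¬ FlatSMulFactors S e},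
        g.1 * e.1 = g.1 ∧ g.1 ≠ e.1 := by
    rintro ⟨e, he, hne⟩
    by_contra! hcon
    refine hne (of_primitive hS he fun f hf hfe => ?_)
    by_contra! hf0
    refine hne ?_
    have hf' : IsIdempotentElem (e - f) := by
      change (e - f) * (e - f) = e - f
      linear_combination he.eq + hf.eq - 2 * hfe
    rw [← add_sub_cancel f e]
    refine add ?_ ?_
    · by_contra hbad
      exact hf0.2 (hcon ⟨f, hf, hbad⟩ hfe)
    · by_contra hbad
      refine hf0.1 (sub_eq_self.1 (hcon ⟨e - f, hf', hbad⟩ ?_))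
      change (e - f) * e = e - f
      linear_combination he.eq - hfe
  choose next hmul hne using step
  let s : ℕ → {e : S // IsIdempotentElem e ∧ ¬ FlatSMulFactors S e} := fun n =>
    next^[n] ⟨1, .one, h1⟩
  have hsucc : ∀ n, s (n + 1) = next (s n) := fun n => Function.iterate_succ_apply' ..
  have hprod : ∀ n, ∏ i ∈ Finset.range (n + 1), (s i).1 = (s n).1 := fun n => by
    induction n with
    | zero => simp
    | succ n ih => rw [Finset.prod_range_succ, ih, hsucc, mul_comm, hmul]
  obtain ⟨m, hm⟩ := hS fun i => (s i).1
  obtain ⟨c, hc⟩ := hm (m + 2) (by omega)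
  refine hne (s m) ?_
  have hPm := hprod m
  have hidem := (s (m + 1)).2.1.eq
  rw [hprod (m + 1)] at hc
  rw [Finset.prod_range_succ, hc] at hPm
  have := hmul (s m)
  rw [← hsucc] at this ⊢
  linear_combination (1 - (s (m + 1)).1) * hPm - this + c * (s m).1 * hidem

end FlatSMulFactors

theorem PrincipalDCC.isPerfectRing {S : Type u} [CommRing S] (hS : PrincipalDCC S) :
    IsPerfectRing S := fun M _ _ hM => by
  obtain ⟨P, _, _, _, α, β, h⟩ := FlatSMulFactors.one hS M hM
  exact .of_split α β (by rw [h, one_smul])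

theorem GabrielTopology.IsACovering.principalDCC_quotient {R : Type u} [CommRing R]
    {G : GabrielTopology R} (hcov : G.IsACovering) (hG : G.IsTiltingTopology) {J : Ideal R}
    (hJ : J ∈ G.sets) : PrincipalDCC (R ⧸ J) := fun a => by
  choose r hr using fun i => Ideal.Quotient.mk_surjective (a i)
  obtain ⟨m, hm⟩ := hcov.exists_prod_sub_mem hG hJ r
  refine ⟨m, fun n hn => ?_⟩
  obtain ⟨w, hw⟩ := hm n hn
  exact ⟨Ideal.Quotient.mk J w, by simpa [hr] using Ideal.Quotient.eq.2 hw⟩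

theorem stmt1 (R : Type u) [CommRing R] (G : GabrielTopology R)
    (hG : G.IsTiltingTopology) (hcov : G.IsACovering) :
    (∀ (Q : Type u) [CommRing Q] [Algebra R Q], G.IsRingOfQuotients Q →
      G.IsPerfectLocalization Q ∧ ProjDimLE1 R Q ∧ IsPerfectRing Q) ∧
    (∀ J ∈ G.sets, IsPerfectRing (R ⧸ J)) := by
  refine ⟨fun Q _ _ hQ => ?_, fun J hJ => (hcov.principalDCC_quotient hG hJ).isPerfectRing⟩
  have h : ∀ J ∈ G.sets, J • (⊤ : Submodule R Q) = ⊤ := fun J hJ =>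
    hQ.smul_top_eq_top hG hcov hJ
  have hperf := hQ.isPerfectLocalization hG.1 h
  have := hperf.1
  exact ⟨hperf, hG.projDimLE1 (hcov.memA_of_flat (M := Q) hG h), hQ.isPerfectRing hG hcov h⟩
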